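/- arXiv:2503.02155 — 2 statements merged into one kernel-verified Lean document; each statement's English description precedes it below -/
import Mathlib

section
/- Under the SGD setup, suppose in addition that ∑_{m=1}^∞ α_m = ∞, ∑_{m=1}^∞ α_m² < ∞, 0 ≤ α_m ≤ 1/L, and E[f(w_1)] < ∞. Then E[|∇f(w_m)|²] → 0 as m → ∞. -/
open Filter MeasureTheory ProbabilityTheory

/-- Deterministic part: vanishing of a nonnegative sequence with slow increase. -/
lemma sgd_seq_tendsto (α G : ℕ → ℝ) (C : ℝ) (hC : 0 ≤ C) (hα : ∀ m, 0 ≤ α m) (hG : ∀ m, 0 ≤ G m)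
    (hdiv : Tendsto (fun M => ∑ m ∈ Finset.range M, α m) atTop atTop)
    (hsq : Summable (fun m => (α m) ^ 2))
    (hsum : Summable (fun m => α m * G m))
    (hstep : ∀ m, G (m + 1) ≤ G m + C * α m * (G m + 1)) :
    Tendsto G atTop (nhds 0) := by
  have hα0 : Tendsto α atTop (nhds 0) := by
    have h := (Real.continuous_sqrt.tendsto 0).comp hsq.tendsto_atTop_zero
    rw [Real.sqrt_zero] at h
    refine h.congr fun m => ?_
    simp [Real.sqrt_sq (hα m)]
  have key : ∀ ε : ℝ, 0 < ε → ∀ᶠ n in atTop, G n < 4 * ε := by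
    intro ε hε
    set K : ℝ := C * (1 + 1 / ε) with hK
    have hK0 : 0 ≤ K := by positivity
    -- small steps
    have h1 : ∀ᶠ j in atTop, C * α j * (ε + 1) < ε := by
      have : Tendsto (fun j => C * α j * (ε + 1)) atTop (nhds (C * 0 * (ε + 1))) :=
        (hα0.const_mul C).mul_const _
      rw [mul_zero, zero_mul] at this
      exact this.eventually_lt_const hε
    -- small tails
    have h2 : ∀ᶠ N in atTop, K * ∑' k, α (k + N) * G (k + N) < ε := by
      have : Tendsto (fun N => K * ∑' k, α (k + N) * G (k + N)) atTop (nhds (K * 0)) :=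
        (tendsto_sum_nat_add (fun m => α m * G m)).const_mul K
      rw [mul_zero] at this
      exact this.eventually_lt_const hε
    obtain ⟨N, hN⟩ := eventually_atTop.1 (h1.and h2)
    have h3 : ∃ n0, N ≤ n0 ∧ G n0 < ε := by
      by_contra! hcon
      have hs : Summable α := by
        rw [← summable_nat_add_iff N]
        refine Summable.of_nonneg_of_le (fun k => hα _) (fun k => ?_)
          (((summable_nat_add_iff N).2 hsum).mul_left (1 / ε))
        have := hcon (k + N) (by omega)
        rw [div_mul_eq_mul_div, one_mul, le_div_iff₀ hε]
        exact mul_le_mul_of_nonneg_left this (hα _)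
      exact not_tendsto_atTop_of_tendsto_nhds hs.hasSum.tendsto_sum_nat hdiv
    obtain ⟨n0, hn0, hGn0⟩ := h3
    have h4 : ∀ k, G (n0 + k) ≤ 2 * ε + K * ∑ j ∈ Finset.range k, α (j + n0) * G (j + n0) := by
      intro k
      induction k with
      | zero => simp; linarith
      | succ k ih =>
        have hS : 0 ≤ ∑ j ∈ Finset.range k, α (j + n0) * G (j + n0) :=
          Finset.sum_nonneg fun j _ => mul_nonneg (hα _) (hG _)
        have hp : 0 ≤ α (n0 + k) * G (n0 + k) := mul_nonneg (hα _) (hG _)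
        have hst := hstep (n0 + k)
        rw [Finset.sum_range_succ, add_comm k n0, ← add_assoc]
        rcases lt_or_ge (G (n0 + k)) ε with hlt | hge
        · have ha := (hN (n0 + k) (by omega)).1
          have hb : C * α (n0 + k) * (G (n0 + k) + 1) ≤ C * α (n0 + k) * (ε + 1) :=
            mul_le_mul_of_nonneg_left (by linarith) (mul_nonneg hC (hα _))
          have hc := mul_nonneg hK0 (add_nonneg hS hp)
          linarith
        · have hb : G (n0 + k) + 1 ≤ (1 + 1 / ε) * G (n0 + k) := by
            have : 1 ≤ 1 / ε * G (n0 + k) := by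
              rw [div_mul_eq_mul_div, one_mul, le_div_iff₀ hε]; linarith
            linarith
          have hc : C * α (n0 + k) * (G (n0 + k) + 1) ≤ K * (α (n0 + k) * G (n0 + k)) := by
            calc _ ≤ C * α (n0 + k) * ((1 + 1 / ε) * G (n0 + k)) :=
                  mul_le_mul_of_nonneg_left hb (mul_nonneg hC (hα _))
              _ = _ := by rw [hK]; ring
          rw [mul_add]
          linarith
    filter_upwards [eventually_ge_atTop n0] with n hn
    obtain ⟨k, rfl⟩ := Nat.exists_eq_add_of_le hn
    have ha := (hN n0 hn0).2
    have hb := ((summable_nat_add_iff n0).2 hsum).sum_le_tsum (Finset.range k)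
      (fun j _ => mul_nonneg (hα _) (hG _))
    have hc := mul_le_mul_of_nonneg_left hb hK0
    have hd := h4 k
    linarith
  rw [Metric.tendsto_atTop]
  intro ε hε
  obtain ⟨N, hN⟩ := eventually_atTop.1 (key (ε / 4) (by positivity))
  refine ⟨N, fun n hn => ?_⟩
  rw [Real.dist_eq, sub_zero, abs_of_nonneg (hG n)]
  have := hN n hn
  linarith

/-- Descent lemma. -/
lemma sgd_descent {E : Type*} [NormedAddCommGroup E] [InnerProductSpace ℝ E] [CompleteSpace E]
    (f : E → ℝ) (L : ℝ) (hf : Differentiable ℝ f)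
    (hlip : ∀ x y, ‖gradient f y - gradient f x‖ ≤ L * ‖y - x‖) (x v : E) :
    f (x + v) ≤ f x + inner ℝ (gradient f x) v + L / 2 * ‖v‖ ^ 2 := by
  have hd : ∀ t : ℝ, HasDerivAt (fun t : ℝ => f (x + t • v))
      (inner ℝ (gradient f (x + t • v)) v) t := by
    intro t
    have h1 : HasDerivAt (fun t : ℝ => x + t • v) v t := by
      simpa using ((hasDerivAt_id t).smul_const v).const_add x
    have h2 := (hf (x + t • v)).hasGradientAt.hasFDerivAt
    exact h2.comp_hasDerivAt t h1
  have hB : ∀ t : ℝ, HasDerivAt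
      (fun t : ℝ => f x + t * inner ℝ (gradient f x) v + L / 2 * ‖v‖ ^ 2 * t ^ 2)
      (inner ℝ (gradient f x) v + L * ‖v‖ ^ 2 * t) t := by
    intro t
    have h1 := (((hasDerivAt_id t).mul_const (inner ℝ (gradient f x) v)).const_add (f x)).add
      (((hasDerivAt_id t).pow 2).const_mul (L / 2 * ‖v‖ ^ 2))
    refine HasDerivAt.congr_deriv h1 ?_
    simp only [id_eq, Nat.cast_ofNat]
    ring
  have := image_le_of_deriv_right_le_deriv_boundary (a := 0) (b := 1)
    (f := fun t : ℝ => f (x + t • v))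
    (f' := fun t => inner ℝ (gradient f (x + t • v)) v)
    (fun t _ => (hd t).continuousAt.continuousWithinAt)
    (fun t _ => (hd t).hasDerivWithinAt)
    (B := fun t : ℝ => f x + t * inner ℝ (gradient f x) v + L / 2 * ‖v‖ ^ 2 * t ^ 2)
    (B' := fun t => inner ℝ (gradient f x) v + L * ‖v‖ ^ 2 * t)
    (by simp)
    (fun t _ => (hB t).continuousAt.continuousWithinAt)
    (fun t _ => (hB t).hasDerivWithinAt)
    (by
      intro t ht
      have h1 : inner ℝ (gradient f (x + t • v) - gradient f x) v ≤
          ‖gradient f (x + t • v) - gradient f x‖ * ‖v‖ := real_inner_le_norm _ _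
      have h2 := hlip x (x + t • v)
      rw [add_sub_cancel_left, norm_smul, Real.norm_of_nonneg ht.1] at h2
      have h3 := mul_le_mul_of_nonneg_right h2 (norm_nonneg v)
      rw [inner_sub_left] at h1
      nlinarith)
    (Set.right_mem_Icc.2 zero_le_one)
  simpa using this

/-- under the SGD setup with `∑ α_m = ∞`, `∑ α_m² < ∞`, `0 ≤ α_m ≤ 1/L`
and `E[f(w_0)] < ∞` (sequences indexed from `0`), `E[‖∇f(w_m)‖²] → 0` as `m → ∞`. -/
theorem stmt9 {d : ℕ} (f : EuclideanSpace ℝ (Fin d) → ℝ) (L σ : ℝ)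
        (hf : ContDiff ℝ 2 f) (hf0 : ∀ x, 0 ≤ f x)
        (hHess : ∀ x, ‖fderiv ℝ (gradient f) x‖ ≤ L) (hL : 0 < L)
        {Ω : Type*} [inst : MeasurableSpace Ω] (μ : Measure Ω) [IsProbabilityMeasure μ]
        (𝓕 : ℕ → MeasurableSpace Ω) (h𝓕 : ∀ m, 𝓕 m ≤ inst)
        (w g : ℕ → Ω → EuclideanSpace ℝ (Fin d)) (α : ℕ → ℝ)
        (hw : ∀ m, StronglyMeasurable[𝓕 m] (w m))
        (hg : ∀ m, AEStronglyMeasurable (g m) μ)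
        (hiter : ∀ m, ∀ ω, w (m + 1) ω = w m ω - α m • g m ω)
        (hunbiased : ∀ m, μ[g m | 𝓕 m] =ᵐ[μ] fun ω => gradient f (w m ω))
        (hg2 : ∀ m, Integrable (fun ω => ‖g m ω‖ ^ 2) μ)
        (hvar : ∀ m, ∫ ω, (‖g m ω‖ ^ 2 - ‖gradient f (w m ω)‖ ^ 2) ∂μ ≤ σ ^ 2)
        (hα : ∀ m, 0 ≤ α m) (hαL : ∀ m, α m ≤ 1 / L)
    (hdiv : Tendsto (fun M => ∑ m ∈ Finset.range M, α m) atTop atTop)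
    (hsq : Summable (fun m => (α m) ^ 2))
    (hint : Integrable (fun ω => f (w 0 ω)) μ) :
    Tendsto (fun m => ∫ ω, ‖gradient f (w m ω)‖ ^ 2 ∂μ) atTop (nhds 0) := by
  classical
  have hdf : Differentiable ℝ f := hf.differentiable (by norm_num)
  have hgrad : ContDiff ℝ 1 (gradient f) :=
    (InnerProductSpace.toDual ℝ (EuclideanSpace ℝ (Fin d))).symm.contDiff.comp
      (hf.fderiv_right (m := 1) (by norm_num))
  have hlip : ∀ x y, ‖gradient f y - gradient f x‖ ≤ L * ‖y - x‖ := fun x y =>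
    convex_univ.norm_image_sub_le_of_norm_fderiv_le
      (fun z _ => (hgrad.differentiable (by norm_num)) z) (fun z _ => hHess z)
      (Set.mem_univ x) (Set.mem_univ y)
  have hgm : ∀ m, MemLp (g m) 2 μ := fun m => (memLp_two_iff_integrable_sq_norm (hg m)).2 (hg2 m)
  have hnm : ∀ m, MemLp (fun ω => gradient f (w m ω)) 2 μ := fun m =>
    (memLp_congr_ae (hunbiased m)).1 ((hgm m).condExp (by norm_num))
  have hn2 : ∀ m, Integrable (fun ω => ‖gradient f (w m ω)‖ ^ 2) μ := fun m =>
    (memLp_two_iff_integrable_sq_norm (hnm m).1).1 (hnm m)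
  have hin : ∀ m, Integrable (fun ω => inner ℝ (gradient f (w m ω)) (g m ω)) μ := by
    intro m
    refine ((hn2 m).add (hg2 m)).mono' ((hnm m).1.inner (hg m)) (ae_of_all _ fun ω => ?_)
    have h1 := norm_inner_le_norm (𝕜 := ℝ) (gradient f (w m ω)) (g m ω)
    change _ ≤ ‖gradient f (w m ω)‖ ^ 2 + ‖g m ω‖ ^ 2
    nlinarith [sq_nonneg (‖gradient f (w m ω)‖ - ‖g m ω‖), sq_nonneg (‖gradient f (w m ω)‖),
      sq_nonneg (‖g m ω‖)]
  have hinE : ∀ m, ∫ ω, inner ℝ (gradient f (w m ω)) (g m ω) ∂μ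
      = ∫ ω, ‖gradient f (w m ω)‖ ^ 2 ∂μ := by
    intro m
    have hsm : StronglyMeasurable[𝓕 m] (fun ω => gradient f (w m ω)) :=
      hgrad.continuous.comp_stronglyMeasurable (hw m)
    have h1 := condExp_bilin_of_stronglyMeasurable_left (μ := μ)
      (innerSL ℝ (E := EuclideanSpace ℝ (Fin d))) hsm (g := g m) (hin m)
      ((hgm m).integrable (by norm_num))
    have h2 := integral_condExp (μ := μ) (h𝓕 m)
      (f := fun ω => innerSL ℝ (gradient f (w m ω)) (g m ω))
    have h3 : ∫ ω, inner ℝ (gradient f (w m ω)) (g m ω) ∂μ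
      = ∫ ω, innerSL ℝ (gradient f (w m ω)) (g m ω) ∂μ := rfl
    rw [h3, ← h2]
    refine integral_congr_ae ?_
    filter_upwards [h1, hunbiased m] with ω ha hb
    rw [ha, hb]
    exact real_inner_self_eq_norm_sq (gradient f (w m ω))
  have hvar' : ∀ m, ∫ ω, ‖g m ω‖ ^ 2 ∂μ ≤ ∫ ω, ‖gradient f (w m ω)‖ ^ 2 ∂μ + σ ^ 2 := by
    intro m
    have := hvar m
    rw [integral_sub (hg2 m) (hn2 m)] at this
    linarith
  have hdesc : ∀ m ω, f (w (m + 1) ω) ≤ f (w m ω)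
      - α m * inner ℝ (gradient f (w m ω)) (g m ω) + L / 2 * α m ^ 2 * ‖g m ω‖ ^ 2 := by
    intro m ω
    have := sgd_descent f L hdf hlip (w m ω) (-(α m • g m ω))
    rw [← sub_eq_add_neg, ← hiter, norm_neg, norm_smul, inner_neg_right, inner_smul_right,
      mul_pow, Real.norm_eq_abs, sq_abs] at this
    linarith
  have hiD : ∀ m, Integrable (fun ω => f (w m ω)) μ → Integrable (fun ω => f (w m ω)
      - α m * inner ℝ (gradient f (w m ω)) (g m ω) + L / 2 * α m ^ 2 * ‖g m ω‖ ^ 2) μ :=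
    fun m h => (h.sub ((hin m).const_mul _)).add ((hg2 m).const_mul _)
  have hfi : ∀ m, Integrable (fun ω => f (w m ω)) μ := by
    intro m
    induction m with
    | zero => exact hint
    | succ m ih =>
      refine (hiD m ih).mono' (hf.continuous.comp_aestronglyMeasurable
        ((hw (m + 1)).mono (h𝓕 _)).aestronglyMeasurable) (ae_of_all _ fun ω => ?_)
      rw [Real.norm_of_nonneg (hf0 _)]
      exact hdesc m ω
  set G : ℕ → ℝ := fun m => ∫ ω, ‖gradient f (w m ω)‖ ^ 2 ∂μ with hGdef
  have hG0 : ∀ m, 0 ≤ G m := fun m => integral_nonneg fun ω => by positivity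
  set F : ℕ → ℝ := fun m => ∫ ω, f (w m ω) ∂μ with hFdef
  have hF0 : ∀ m, 0 ≤ F m := fun m => integral_nonneg fun ω => hf0 _
  have hαL' : ∀ m, L * α m ≤ 1 := fun m => by
    have := hαL m
    rw [le_div_iff₀ hL] at this
    linarith
  have hFstep : ∀ m, F (m + 1) ≤ F m - α m / 2 * G m + L / 2 * σ ^ 2 * α m ^ 2 := by
    intro m
    have h1 : F (m + 1) ≤ F m - α m * G m + L / 2 * α m ^ 2 * ∫ ω, ‖g m ω‖ ^ 2 ∂μ := by
      refine (integral_mono (hfi (m + 1)) (hiD m (hfi m)) (hdesc m)).trans ?_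
      have ha : Integrable (fun ω => f (w m ω)
          - α m * inner ℝ (gradient f (w m ω)) (g m ω)) μ := (hfi m).sub ((hin m).const_mul _)
      rw [integral_add ha ((hg2 m).const_mul _),
        integral_sub (hfi m) ((hin m).const_mul _), integral_const_mul, integral_const_mul, hinE]
    have h2 := mul_le_mul_of_nonneg_left (hvar' m) (show 0 ≤ L / 2 * α m ^ 2 by positivity)
    have h3 : 0 ≤ (1 - L * α m) * (α m * G m) :=
      mul_nonneg (by linarith [hαL' m]) (mul_nonneg (hα m) (hG0 m))
    change L / 2 * α m ^ 2 * ∫ ω, ‖g m ω‖ ^ 2 ∂μ ≤ L / 2 * α m ^ 2 * (G m + σ ^ 2) at h2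
    nlinarith
  have hGstep : ∀ m, G (m + 1) ≤ G m + (3 * L + 2 * L * σ ^ 2) * α m * (G m + 1) := by
    intro m
    have hpt : ∀ ω, ‖gradient f (w (m + 1) ω)‖ ^ 2 ≤
        (1 + L * α m) * ‖gradient f (w m ω)‖ ^ 2 + 2 * (L * α m) * ‖g m ω‖ ^ 2 := by
      intro ω
      have h1 := hlip (w m ω) (w (m + 1) ω)
      have h2 : ‖w (m + 1) ω - w m ω‖ = α m * ‖g m ω‖ := by
        rw [hiter, sub_sub_cancel_left, norm_neg, norm_smul, Real.norm_of_nonneg (hα m)]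
      rw [h2] at h1
      have h3 := norm_sub_norm_le (gradient f (w (m + 1) ω)) (gradient f (w m ω))
      have h4 : ‖gradient f (w (m + 1) ω)‖ ≤
          ‖gradient f (w m ω)‖ + (L * α m) * ‖g m ω‖ := by linarith
      have h5 := pow_le_pow_left₀ (norm_nonneg _) h4 2
      have h6 : 0 ≤ L * α m := mul_nonneg hL.le (hα m)
      have h7 := mul_nonneg h6 (sq_nonneg (‖gradient f (w m ω)‖ - ‖g m ω‖))
      have h8 := mul_nonneg (mul_nonneg h6 (sub_nonneg.2 (hαL' m))) (sq_nonneg ‖g m ω‖)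
      linarith
    have h1 : G (m + 1) ≤ (1 + L * α m) * G m + 2 * (L * α m) * ∫ ω, ‖g m ω‖ ^ 2 ∂μ := by
      have ha : Integrable (fun ω => (1 + L * α m) * ‖gradient f (w m ω)‖ ^ 2
          + 2 * (L * α m) * ‖g m ω‖ ^ 2) μ := ((hn2 m).const_mul _).add ((hg2 m).const_mul _)
      refine (integral_mono (hn2 (m + 1)) ha hpt).trans ?_
      rw [integral_add ((hn2 m).const_mul _) ((hg2 m).const_mul _), integral_const_mul,
        integral_const_mul]
    have h6 : 0 ≤ L * α m := mul_nonneg hL.le (hα m)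
    have h2 := mul_le_mul_of_nonneg_left (hvar' m) (show 0 ≤ 2 * (L * α m) by positivity)
    change 2 * (L * α m) * ∫ ω, ‖g m ω‖ ^ 2 ∂μ ≤ 2 * (L * α m) * (G m + σ ^ 2) at h2
    have h3 : 0 ≤ L * α m * (σ ^ 2 * G m) := mul_nonneg h6 (mul_nonneg (sq_nonneg σ) (hG0 m))
    linarith
  have hsum : Summable (fun m => α m * G m) := by
    have hb : ∀ n, F n + 1 / 2 * ∑ m ∈ Finset.range n, α m * G m ≤
        F 0 + L / 2 * σ ^ 2 * ∑ m ∈ Finset.range n, α m ^ 2 := by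
      intro n
      induction n with
      | zero => simp
      | succ n ih =>
        rw [Finset.sum_range_succ, Finset.sum_range_succ]
        have := hFstep n
        linarith
    refine summable_of_sum_range_le (c := 2 * (F 0 + L / 2 * σ ^ 2 * ∑' m, α m ^ 2))
      (fun m => mul_nonneg (hα m) (hG0 m)) fun n => ?_
    have h1 := hsq.sum_le_tsum (Finset.range n) (fun j _ => sq_nonneg _)
    have h2 := mul_le_mul_of_nonneg_left h1 (show 0 ≤ L / 2 * σ ^ 2 by positivity)
    have h3 := hb n
    have h4 := hF0 n
    linarith
  exact sgd_seq_tendsto α G (3 * L + 2 * L * σ ^ 2) (by positivity) hα hG0 hdiv hsq hsum hGstep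
end

section
/- Under the SGD setup, suppose in addition that 0 ≤ α_m ≤ 1/L, α_m → 0 as m → ∞, E[f(w_1)] < ∞, and that f satisfies the growth condition f(w) ≤ C₁ + C₂|∇f(w)|² for all w, for some constants C₁, C₂ > 0. Then E[f(w_m)] < ∞ for all m; moreover the sequence E[f(w_m)] is uniformly bounded. -/
open Filter MeasureTheory ProbabilityTheory

theorem aux_grad_contDiff {d : ℕ} {f : EuclideanSpace ℝ (Fin d) → ℝ} (hf : ContDiff ℝ 2 f) :
    ContDiff ℝ 1 (gradient f) := by
  have h1 : ContDiff ℝ 1 (fderiv ℝ f) := hf.fderiv_right (by norm_num)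
  exact (InnerProductSpace.toDual ℝ (EuclideanSpace ℝ (Fin d))).symm.contDiff.comp h1

theorem aux_descent {d : ℕ} {f : EuclideanSpace ℝ (Fin d) → ℝ} {L : ℝ} (hf : ContDiff ℝ 2 f)
    (hHess : ∀ x, ‖fderiv ℝ (gradient f) x‖ ≤ L) (x v : EuclideanSpace ℝ (Fin d)) :
    f (x + v) ≤ f x + inner ℝ (gradient f x) v + L / 2 * ‖v‖ ^ 2 := by
  have hG : Differentiable ℝ (gradient f) := (aux_grad_contDiff hf).differentiable (by norm_num)
  have hfd : Differentiable ℝ f := hf.differentiable (by norm_num)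
  have hlip : ∀ y, ‖gradient f y - gradient f x‖ ≤ L * ‖y - x‖ := fun y =>
    convex_univ.norm_image_sub_le_of_norm_fderiv_le (𝕜 := ℝ) (fun z _ => hG z)
      (fun z _ => hHess z) (Set.mem_univ x) (Set.mem_univ y)
  have hder : ∀ t : ℝ, HasDerivAt (fun t : ℝ => f (x + t • v) - t * inner ℝ (gradient f x) v
      - L / 2 * t ^ 2 * ‖v‖ ^ 2)
      (inner ℝ (gradient f (x + t • v)) v - inner ℝ (gradient f x) v - L * t * ‖v‖ ^ 2) t := by
    intro t
    have h1 : HasDerivAt (fun t : ℝ => x + t • v) v t := by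
      simpa using ((hasDerivAt_id t).smul_const v).const_add x
    have h2 := (hfd (x + t • v)).hasFDerivAt.comp_hasDerivAt t h1
    rw [← inner_gradient_left] at h2
    have h3 := (hasDerivAt_id t).mul_const (inner ℝ (gradient f x) v)
    have h4 := (((hasDerivAt_id t).pow 2).const_mul (L / 2)).mul_const (‖v‖ ^ 2)
    refine ((h2.sub h3).sub h4).congr_deriv ?_
    have h5 : (id t : ℝ) = t := rfl
    rw [h5]
    norm_num only [Nat.cast_ofNat, pow_one]
    ring
  have hanti := antitoneOn_of_deriv_nonpos (convex_Icc (0 : ℝ) 1)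
    (fun t _ => (hder t).continuousAt.continuousWithinAt)
    (fun t _ => (hder t).differentiableAt.differentiableWithinAt) (by
      intro t ht
      rw [interior_Icc] at ht
      rw [(hder t).deriv, ← inner_sub_left]
      have h1 := real_inner_le_norm (gradient f (x + t • v) - gradient f x) v
      have h2 := hlip (x + t • v)
      rw [add_sub_cancel_left, norm_smul, Real.norm_of_nonneg ht.1.le] at h2
      have h3 := mul_le_mul_of_nonneg_right h2 (norm_nonneg v)
      nlinarith)
  have := hanti (Set.left_mem_Icc.2 zero_le_one) (Set.right_mem_Icc.2 zero_le_one) zero_le_one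
  simp [-inner_gradient_left] at this
  linarith

theorem aux_grad_sq {d : ℕ} {f : EuclideanSpace ℝ (Fin d) → ℝ} {L : ℝ} (hf : ContDiff ℝ 2 f)
    (hf0 : ∀ x, 0 ≤ f x) (hL : 0 < L)
    (hHess : ∀ x, ‖fderiv ℝ (gradient f) x‖ ≤ L) (x : EuclideanSpace ℝ (Fin d)) :
    ‖gradient f x‖ ^ 2 ≤ 2 * L * f x := by
  have h := aux_descent hf hHess x (-(1 / L) • gradient f x)
  have h0 := hf0 (x + -(1 / L) • gradient f x)
  rw [inner_smul_right, real_inner_self_eq_norm_sq, norm_smul, mul_pow, Real.norm_eq_abs,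
    sq_abs] at h
  have h1 : 0 ≤ f x - 1 / (2 * L) * ‖gradient f x‖ ^ 2 := by
    have : L / 2 * ((-(1 / L)) ^ 2 * ‖gradient f x‖ ^ 2) = 1 / (2 * L) * ‖gradient f x‖ ^ 2 := by
      field_simp
    have h2 : 1 / L * ‖gradient f x‖ ^ 2 = 2 * (1 / (2 * L) * ‖gradient f x‖ ^ 2) := by
      field_simp
    linarith
  have h3 : 2 * L * (f x - 1 / (2 * L) * ‖gradient f x‖ ^ 2)
      = 2 * L * f x - ‖gradient f x‖ ^ 2 := by field_simp
  have h4 := mul_nonneg (by positivity : 0 ≤ 2 * L) h1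
  linarith

/-- finiteness of `E[f(w_m)]` under a growth condition. Under the SGD
setup with `0 ≤ α_m ≤ 1/L`, `α_m → 0`, `E[f(w_0)] < ∞`, and
`f(w) ≤ C₁ + C₂‖∇f(w)‖²` for all `w` with `C₁, C₂ > 0` (sequences indexed from `0`),
every `E[f(w_m)]` is finite (i.e. `f(w_m)` is integrable), and the sequence `E[f(w_m)]`
is uniformly bounded. -/
theorem stmt14 {d : ℕ} (f : EuclideanSpace ℝ (Fin d) → ℝ) (L σ : ℝ)
        (hf : ContDiff ℝ 2 f) (hf0 : ∀ x, 0 ≤ f x)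
        (hHess : ∀ x, ‖fderiv ℝ (gradient f) x‖ ≤ L) (hL : 0 < L)
        {Ω : Type*} [inst : MeasurableSpace Ω] (μ : Measure Ω) [IsProbabilityMeasure μ]
        (𝓕 : ℕ → MeasurableSpace Ω) (h𝓕 : ∀ m, 𝓕 m ≤ inst)
        (w g : ℕ → Ω → EuclideanSpace ℝ (Fin d)) (α : ℕ → ℝ)
        (hw : ∀ m, StronglyMeasurable[𝓕 m] (w m))
        (hg : ∀ m, AEStronglyMeasurable (g m) μ)
        (hiter : ∀ m, ∀ ω, w (m + 1) ω = w m ω - α m • g m ω)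
        (hunbiased : ∀ m, μ[g m | 𝓕 m] =ᵐ[μ] fun ω => gradient f (w m ω))
        (hg2 : ∀ m, Integrable (fun ω => ‖g m ω‖ ^ 2) μ)
        (hvar : ∀ m, ∫ ω, (‖g m ω‖ ^ 2 - ‖gradient f (w m ω)‖ ^ 2) ∂μ ≤ σ ^ 2)
        (hα : ∀ m, 0 ≤ α m) (hαL : ∀ m, α m ≤ 1 / L)
    (hα0 : Tendsto α atTop (nhds 0))
    (hint : Integrable (fun ω => f (w 0 ω)) μ)
    (C₁ C₂ : ℝ) (hC₁ : 0 < C₁) (hC₂ : 0 < C₂)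
    (hgrowth : ∀ x, f x ≤ C₁ + C₂ * ‖gradient f x‖ ^ 2) :
    (∀ m, Integrable (fun ω => f (w m ω)) μ) ∧
      ∃ B : ℝ, ∀ m, (∫ ω, f (w m ω) ∂μ) ≤ B := by
  have hGc : Continuous (gradient f) := (aux_grad_contDiff hf).continuous
  have hfc : Continuous f := hf.continuous
  have hwm : ∀ m, StronglyMeasurable (w m) := fun m => (hw m).mono (h𝓕 m)
  have step : ∀ m, Integrable (fun ω => f (w m ω)) μ →
      Integrable (fun ω => f (w (m + 1) ω)) μ ∧
      Integrable (fun ω => ‖gradient f (w m ω)‖ ^ 2) μ ∧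
      (∫ ω, f (w (m + 1) ω) ∂μ) ≤ (∫ ω, f (w m ω) ∂μ)
        - α m / 2 * (∫ ω, ‖gradient f (w m ω)‖ ^ 2 ∂μ) + α m * σ ^ 2 / 2 := by
    intro m hm
    have hGs : StronglyMeasurable[𝓕 m] (fun ω => gradient f (w m ω)) :=
      hGc.comp_stronglyMeasurable (hw m)
    have hGs' : StronglyMeasurable (fun ω => gradient f (w m ω)) := hGs.mono (h𝓕 m)
    have hG2 : Integrable (fun ω => ‖gradient f (w m ω)‖ ^ 2) μ := by
      refine (hm.const_mul (2 * L)).mono' (hGs'.norm.pow 2).aestronglyMeasurable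
        (Eventually.of_forall fun ω => ?_)
      rw [Real.norm_of_nonneg (by positivity)]
      exact aux_grad_sq hf hf0 hL hHess _
    have hgi : Integrable (g m) μ := by
      refine ((hg2 m).add (integrable_const (1 : ℝ))).mono' (hg m)
        (Eventually.of_forall fun ω => ?_)
      simp only [Pi.add_apply]
      nlinarith [sq_nonneg (‖g m ω‖ - 1)]
    have hin : Integrable (fun ω => inner ℝ (gradient f (w m ω)) (g m ω)) μ := by
      refine (hG2.add (hg2 m)).mono' (hGs'.aestronglyMeasurable.inner (hg m))
        (Eventually.of_forall fun ω => ?_)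
      have := norm_inner_le_norm (𝕜 := ℝ) (gradient f (w m ω)) (g m ω)
      simp only [Pi.add_apply]
      nlinarith [sq_nonneg (‖gradient f (w m ω)‖ - ‖g m ω‖), norm_nonneg (g m ω),
        norm_nonneg (gradient f (w m ω))]
    have hinE : (∫ ω, inner ℝ (gradient f (w m ω)) (g m ω) ∂μ)
        = ∫ ω, ‖gradient f (w m ω)‖ ^ 2 ∂μ := by
      have hp := condExp_bilin_of_stronglyMeasurable_left (μ := μ)
        (innerSL ℝ (E := EuclideanSpace ℝ (Fin d))) hGs hin hgi
      rw [← integral_condExp (h𝓕 m)]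
      refine integral_congr_ae ?_
      filter_upwards [hp, hunbiased m] with ω h1 h2
      rw [h2] at h1
      refine h1.trans ?_
      exact real_inner_self_eq_norm_sq (gradient f (w m ω))
    have hdes : ∀ ω, f (w (m + 1) ω) ≤ f (w m ω)
        - α m * inner ℝ (gradient f (w m ω)) (g m ω) + L / 2 * α m ^ 2 * ‖g m ω‖ ^ 2 := by
      intro ω
      have h := aux_descent hf hHess (w m ω) (-(α m) • g m ω)
      rw [inner_smul_right, norm_smul, mul_pow, Real.norm_eq_abs, sq_abs, neg_smul,
        ← sub_eq_add_neg, ← hiter] at h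
      linarith
    have hI1 := hm.sub (hin.const_mul (α m))
    have hI2 := (hg2 m).const_mul (L / 2 * α m ^ 2)
    have hI := hI1.add hI2
    have hnext : Integrable (fun ω => f (w (m + 1) ω)) μ := by
      refine hI.mono' (hfc.comp_stronglyMeasurable (hwm (m + 1))).aestronglyMeasurable
        (Eventually.of_forall fun ω => ?_)
      rw [Real.norm_of_nonneg (hf0 _)]
      exact hdes ω
    refine ⟨hnext, hG2, ?_⟩
    have hle := integral_mono hnext hI hdes
    rw [integral_add' hI1 hI2, integral_sub' hm (hin.const_mul (α m)), integral_const_mul,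
      integral_const_mul, hinE] at hle
    have hv := hvar m
    rw [integral_sub (hg2 m) hG2] at hv
    have hLα : L * α m ≤ 1 := by
      have := mul_le_mul_of_nonneg_left (hαL m) hL.le
      rwa [mul_one_div_cancel hL.ne'] at this
    have hG0 : 0 ≤ ∫ ω, ‖gradient f (w m ω)‖ ^ 2 ∂μ := integral_nonneg fun ω => by positivity
    have ha := hα m
    generalize (∫ ω, ‖gradient f (w m ω)‖ ^ 2 ∂μ) = G at *
    generalize (∫ ω, ‖g m ω‖ ^ 2 ∂μ) = H at *
    have h1 : L / 2 * α m ^ 2 * H ≤ L / 2 * α m ^ 2 * (σ ^ 2 + G) :=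
      mul_le_mul_of_nonneg_left (by linarith) (by positivity)
    have h2 : (L * α m) * (α m / 2 * (σ ^ 2 + G)) ≤ 1 * (α m / 2 * (σ ^ 2 + G)) :=
      mul_le_mul_of_nonneg_right hLα (by positivity)
    linarith
  have hall : ∀ m, Integrable (fun ω => f (w m ω)) μ := by
    intro m
    induction m with
    | zero => exact hint
    | succ k ih => exact (step k ih).1
  refine ⟨hall, max (∫ ω, f (w 0 ω) ∂μ) (C₁ + C₂ * σ ^ 2 + σ ^ 2 / (2 * L)), fun m => ?_⟩
  induction m with
  | zero => exact le_max_left _ _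
  | succ k ih =>
    obtain ⟨-, hG2, hle⟩ := step k (hall k)
    have hgr : (∫ ω, f (w k ω) ∂μ) ≤ C₁ + C₂ * ∫ ω, ‖gradient f (w k ω)‖ ^ 2 ∂μ := by
      have := integral_mono (hall k) ((integrable_const C₁).add (hG2.const_mul C₂))
        (fun ω => hgrowth (w k ω))
      rw [integral_add' (integrable_const C₁) (hG2.const_mul C₂), integral_const_mul] at this
      simpa using this
    have hG0 : 0 ≤ ∫ ω, ‖gradient f (w k ω)‖ ^ 2 ∂μ := integral_nonneg fun ω => by positivity
    have ha := hα k
    rcases le_total (∫ ω, ‖gradient f (w k ω)‖ ^ 2 ∂μ) (σ ^ 2) with h | h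
    · refine le_trans ?_ (le_max_right _ _)
      have h1 := mul_le_mul_of_nonneg_left h hC₂.le
      have h2 : α k * σ ^ 2 / 2 ≤ σ ^ 2 / (2 * L) := by
        have := mul_le_mul_of_nonneg_right (hαL k) (by positivity : 0 ≤ σ ^ 2 / 2)
        calc _ = α k * (σ ^ 2 / 2) := by ring
          _ ≤ _ := this
          _ = _ := by field_simp
      have h3 := mul_nonneg (div_nonneg ha zero_le_two) hG0
      linarith
    · refine le_trans ?_ ih
      have := mul_le_mul_of_nonneg_left h (div_nonneg ha zero_le_two)
      linarith
end
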